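/- Let F_q be a finite field of odd characteristic p, m a positive integer dividing q - 1, and ψ any multiplicative character of F_q. Then the Hasse–Davenport product relation holds: ∏_{χ: χ^m = ε} g(χψ) = -g(ψ^m) ψ(m^{-m}) ∏_{χ: χ^m = ε} g(χ), where both products range over all multiplicative characters χ of F_q with χ^m trivial, and g denotes the Gauss sum. -/

import Mathlib

namespace HasseDavenport

open Polynomial Finset

theorem map_pow_of_monic {F : Type*} [Field F] {R : Type*} [CommRing R] {w : F[X] → R}
    (h1 : w 1 = 1) (hw : ∀ f g : F[X], f.Monic → g.Monic → w (f * g) = w f * w g)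
    {P : F[X]} (hP : P.Monic) (j : ℕ) : w (P ^ j) = w P ^ j := by
  induction j with
  | zero => simpa using h1
  | succ j ih => rw [pow_succ, hw _ _ (hP.pow j) hP, ih, pow_succ]

section
variable {F : Type*} [Field F] [Finite F]

theorem finite_setOf_monic_natDegree_eq (F : Type*) [Field F] [Finite F] (n : ℕ) :
    {f : F[X] | f.Monic ∧ f.natDegree = n}.Finite := by
  refine Set.Finite.of_injOn (t := (Set.univ : Set (Fin (n + 1) → F)))
    (f := fun f (i : Fin (n + 1)) ↦ f.coeff i) (fun _ _ ↦ Set.mem_univ _) ?_ Set.finite_univ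
  intro f hf g hg h
  ext i
  by_cases hi : i < n + 1
  · exact congrFun h ⟨i, hi⟩
  · rw [coeff_eq_zero_of_natDegree_lt (by grind), coeff_eq_zero_of_natDegree_lt (by grind)]

/-- The finite set of monic polynomials of degree `n` over a finite field. -/
noncomputable def monicsOfDegree (F : Type*) [Field F] [Finite F] (n : ℕ) : Finset F[X] :=
  (finite_setOf_monic_natDegree_eq F n).toFinset

theorem mem_monicsOfDegree {n : ℕ} {f : F[X]} :
    f ∈ monicsOfDegree F n ↔ f.Monic ∧ f.natDegree = n := by
  simp [monicsOfDegree]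

open Classical in
/-- The finite set of monic irreducible polynomials of degree at most `n`. -/
noncomputable def monicIrreducibles (F : Type*) [Field F] [Finite F] (n : ℕ) : Finset F[X] :=
  {f ∈ (range (n + 1)).biUnion (monicsOfDegree F) | Irreducible f}

theorem mem_monicIrreducibles {n : ℕ} {P : F[X]} :
    P ∈ monicIrreducibles F n ↔ P.Monic ∧ Irreducible P ∧ P.natDegree ≤ n := by
  simp only [monicIrreducibles, mem_filter, mem_biUnion, mem_range, mem_monicsOfDegree]
  grind

theorem filter_monicIrreducibles_dvd {k n : ℕ} (hk : 0 < k) (hkn : k ≤ n) :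
    {P ∈ monicIrreducibles F k | P.natDegree ∣ k} =
      {P ∈ monicIrreducibles F n | P.natDegree ∣ k} := by
  ext P
  simp only [mem_filter, mem_monicIrreducibles]
  constructor
  · rintro ⟨⟨h1, h2, h3⟩, h4⟩
    exact ⟨⟨h1, h2, h3.trans hkn⟩, h4⟩
  · rintro ⟨⟨h1, h2, h3⟩, h4⟩
    exact ⟨⟨h1, h2, Nat.le_of_dvd hk h4⟩, h4⟩

open UniqueFactorizationMonoid in
theorem sum_natDegree_mul_multiplicity {n : ℕ} {f : F[X]} (hf : f ∈ monicsOfDegree F n) :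
    ∑ P ∈ monicIrreducibles F n, P.natDegree * multiplicity P f = n := by
  classical
  obtain ⟨hm, hn⟩ := mem_monicsOfDegree.1 hf
  have hmem : ∀ P ∈ normalizedFactors f, P.Monic ∧ Irreducible P ∧ P ∣ f := fun P hP ↦
    ⟨by
      rw [← normalize_normalized_factor P hP]
      exact monic_normalize (irreducible_of_normalized_factor P hP).ne_zero,
      irreducible_of_normalized_factor P hP, dvd_of_mem_normalizedFactors hP⟩
  have hprod : (normalizedFactors f).prod = f := by
    rw [prod_normalizedFactors_eq hm.ne_zero, hm.normalize_eq_self]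
  have hdeg : ((normalizedFactors f).map natDegree).sum = n := by
    rw [← natDegree_multiset_prod_of_monic _ (fun P hP ↦ (hmem P hP).1), hprod, hn]
  rw [Finset.sum_multiset_map_count] at hdeg
  refine Eq.trans (Eq.symm ?_) hdeg
  refine (Finset.sum_subset_zero_on_sdiff (fun P hP ↦ ?_) (fun P hP ↦ ?_) (fun P hP ↦ ?_))
  · obtain ⟨h1, h2, h3⟩ := hmem P (Multiset.mem_toFinset.1 hP)
    exact mem_monicIrreducibles.2 ⟨h1, h2, (natDegree_le_of_dvd h3 hm.ne_zero).trans hn.le⟩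
  · obtain ⟨hP1, hP2⟩ := Finset.mem_sdiff.1 hP
    obtain ⟨h1, h2, h3⟩ := mem_monicIrreducibles.1 hP1
    rw [multiplicity_eq_zero.2, mul_zero]
    intro hd
    apply hP2
    rw [Multiset.mem_toFinset, mem_normalizedFactors_iff' hm.ne_zero]
    exact ⟨h2, h1.normalize_eq_self, hd⟩
  · obtain ⟨h1, h2, h3⟩ := hmem P (Multiset.mem_toFinset.1 hP)
    have hfin : FiniteMultiplicity P f := FiniteMultiplicity.of_not_isUnit h2.not_isUnit hm.ne_zero
    have := emultiplicity_eq_count_normalizedFactors h2 hm.ne_zero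
    rw [h1.normalize_eq_self, hfin.emultiplicity_eq_multiplicity] at this
    rw [smul_eq_mul, mul_comm, Nat.cast_injective this]

open Classical in
theorem sum_natDegree_of_pow_dvd {n : ℕ} {f : F[X]} (hf : f ∈ monicsOfDegree F n) :
    ∑ k ∈ Icc 1 n, ∑ P ∈ monicIrreducibles F k with P.natDegree ∣ k,
      (if P ^ (k / P.natDegree) ∣ f then P.natDegree else 0) = n := by
  obtain ⟨hm, hn⟩ := mem_monicsOfDegree.1 hf
  conv_rhs => rw [← sum_natDegree_mul_multiplicity hf]
  have : ∀ k ∈ Icc 1 n, ∑ P ∈ monicIrreducibles F k with P.natDegree ∣ k,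
      (if P ^ (k / P.natDegree) ∣ f then P.natDegree else 0) =
      ∑ P ∈ monicIrreducibles F n, if P.natDegree ∣ k ∧ P ^ (k / P.natDegree) ∣ f
        then P.natDegree else 0 := by
    intro k hk
    rw [mem_Icc] at hk
    rw [filter_monicIrreducibles_dvd hk.1 hk.2, sum_filter]
    exact sum_congr rfl fun P _ ↦ by rw [ite_and]
  rw [sum_congr rfl this, sum_comm]
  refine sum_congr rfl fun P hP ↦ ?_
  obtain ⟨h1, h2, h3⟩ := mem_monicIrreducibles.1 hP
  have hd : 0 < P.natDegree := h2.natDegree_pos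
  have hfin : FiniteMultiplicity P f := FiniteMultiplicity.of_not_isUnit h2.not_isUnit hm.ne_zero
  rw [← sum_filter, sum_const, smul_eq_mul, mul_comm]
  congr 1
  rw [← Nat.add_sub_cancel (multiplicity P f) 1, ← Nat.card_Icc]
  refine card_nbij' (· / P.natDegree) (· * P.natDegree) ?_ ?_ ?_ ?_
  · intro k hk
    simp only [coe_filter, mem_Icc, Set.mem_ofPred_eq] at hk
    obtain ⟨⟨hk1, hk2⟩, hk3, hk4⟩ := hk
    simp only [coe_Icc, Set.mem_Icc]
    exact ⟨Nat.div_pos (Nat.le_of_dvd hk1 hk3) hd, hfin.le_multiplicity_of_pow_dvd hk4⟩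
  · intro j hj
    simp only [coe_Icc, Set.mem_Icc] at hj
    have hdvd : P ^ j ∣ f := pow_dvd_of_le_multiplicity hj.2
    simp only [coe_filter, mem_Icc, Set.mem_ofPred_eq, dvd_mul_left, Nat.mul_div_cancel _ hd, hdvd,
      and_true]
    refine ⟨Nat.mul_pos hj.1 hd, ?_⟩
    rw [← hn, ← natDegree_pow]
    exact natDegree_le_of_dvd hdvd hm.ne_zero
  · intro k hk
    simp only [coe_filter, mem_Icc, Set.mem_ofPred_eq] at hk
    exact Nat.div_mul_cancel hk.2.1
  · intro j _
    exact Nat.mul_div_cancel _ hd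

open Classical in
theorem sum_monicsOfDegree_of_dvd {R : Type*} [CommRing R] {w : F[X] → R}
    (hw : ∀ f g : F[X], f.Monic → g.Monic → w (f * g) = w f * w g) {n : ℕ} {ij : ℕ × ℕ}
    (hij : ij ∈ antidiagonal n) {Q : F[X]} (hQ : Q.Monic) (hd : Q.natDegree = ij.2) :
    ∑ f ∈ monicsOfDegree F n with Q ∣ f, w f = (∑ f ∈ monicsOfDegree F ij.1, w f) * w Q := by
  rw [HasAntidiagonal.mem_antidiagonal] at hij
  rw [sum_mul]
  symm
  refine sum_nbij (· * Q) (fun g hg ↦ ?_) (fun g _ h _ he ↦ ?_) (fun f hf ↦ ?_) (fun g hg ↦ ?_)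
  · rw [mem_monicsOfDegree] at hg
    rw [mem_filter, mem_monicsOfDegree, hg.1.natDegree_mul hQ, hd, hg.2]
    exact ⟨⟨hg.1.mul hQ, hij⟩, dvd_mul_left _ _⟩
  · exact mul_right_cancel₀ hQ.ne_zero he
  · simp only [coe_filter, Set.mem_ofPred_eq, mem_monicsOfDegree] at hf
    obtain ⟨⟨h1, h2⟩, g, rfl⟩ := hf
    have hg : g.Monic := hQ.of_mul_monic_left h1
    rw [hQ.natDegree_mul hg] at h2
    exact ⟨g, mem_coe.2 (mem_monicsOfDegree.2 ⟨hg, by lia⟩), mul_comm _ _⟩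
  · exact (hw g Q (mem_monicsOfDegree.1 hg).1 hQ).symm

/-- Newton's identity relating the coefficients of the Dirichlet series of a completely
multiplicative function on monic polynomials to those of its logarithmic derivative. -/
theorem natCast_mul_sum_monicsOfDegree {R : Type*} [CommRing R] {w : F[X] → R} (h1 : w 1 = 1)
    (hw : ∀ f g : F[X], f.Monic → g.Monic → w (f * g) = w f * w g) (n : ℕ) :
    (n : R) * ∑ f ∈ monicsOfDegree F n, w f =
      ∑ ij ∈ antidiagonal n with ij.1 < n, (∑ f ∈ monicsOfDegree F ij.1, w f) *
        ∑ P ∈ monicIrreducibles F ij.2 with P.natDegree ∣ ij.2,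
          (P.natDegree : R) * w P ^ (ij.2 / P.natDegree) := by
  classical
  have hstep : ∀ f ∈ monicsOfDegree F n, (n : R) * w f =
      ∑ ij ∈ antidiagonal n with ij.1 < n,
        ∑ P ∈ monicIrreducibles F ij.2 with P.natDegree ∣ ij.2,
          if P ^ (ij.2 / P.natDegree) ∣ f then (P.natDegree : R) * w f else 0 := by
    intro f hf
    conv_lhs => rw [← sum_natDegree_of_pow_dvd hf]
    push_cast
    simp only [sum_mul, ite_mul, zero_mul]
    refine sum_nbij' (fun k ↦ (n - k, k)) Prod.snd ?_ ?_ ?_ ?_ ?_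
    · intro k hk
      simp only [mem_Icc, mem_filter, HasAntidiagonal.mem_antidiagonal] at hk ⊢
      lia
    · intro k hk
      simp only [mem_Icc, mem_filter, HasAntidiagonal.mem_antidiagonal] at hk ⊢
      lia
    · simp
    · intro k hk
      simp only [mem_filter, HasAntidiagonal.mem_antidiagonal] at hk
      ext <;> simp; lia
    · simp
  rw [mul_sum, sum_congr rfl hstep, sum_comm]
  refine sum_congr rfl fun ij hij ↦ ?_
  rw [sum_comm, mul_sum]
  refine sum_congr rfl fun P hP ↦ ?_
  rw [mem_filter, mem_monicIrreducibles] at hP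
  rw [← sum_filter, ← mul_sum, sum_monicsOfDegree_of_dvd hw (mem_filter.1 hij).1 (hP.1.1.pow _)
    (by rw [natDegree_pow, Nat.div_mul_cancel hP.2]), map_pow_of_monic h1 hw hP.1.1]
  ring

end

section
variable {F K : Type*} [Field F] [Field K]

/-- The generating series `∑ pₘ Xᵐ` of the power sums of the roots of a polynomial, as the
logarithmic derivative of its reversal. -/
noncomputable def powerSumSeries (f : F[X]) : PowerSeries F :=
  -(PowerSeries.X * ((derivative f.reverse : F[X]) : PowerSeries F)) * (f.reverse : PowerSeries F)⁻¹

/-- The sum of the `m`-th powers of the roots of a polynomial, for `0 < m`. -/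
noncomputable def powerSum (m : ℕ) (f : F[X]) : F :=
  PowerSeries.coeff m (powerSumSeries f)

theorem constantCoeff_reverse {f : F[X]} (hf : f.Monic) :
    PowerSeries.constantCoeff (f.reverse : PowerSeries F) = 1 := by
  simp [hf.leadingCoeff]

theorem reverse_toPowerSeries_ne_zero {f : F[X]} (hf : f.Monic) :
    (f.reverse : PowerSeries F) ≠ 0 := by
  intro h
  simpa [h] using constantCoeff_reverse hf

theorem reverse_mul_powerSumSeries {f : F[X]} (hf : f.Monic) :
    (f.reverse : PowerSeries F) * powerSumSeries f =
      -(PowerSeries.X * ((derivative f.reverse : F[X]) : PowerSeries F)) := by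
  rw [powerSumSeries, mul_left_comm, PowerSeries.mul_inv_cancel, mul_one]
  rw [constantCoeff_reverse hf]
  exact one_ne_zero

theorem powerSumSeries_eq {f : F[X]} (hf : f.Monic) {s : PowerSeries F}
    (hs : (f.reverse : PowerSeries F) * s =
      -(PowerSeries.X * ((derivative f.reverse : F[X]) : PowerSeries F))) : powerSumSeries f = s :=
  mul_left_cancel₀ (reverse_toPowerSeries_ne_zero hf)
    ((reverse_mul_powerSumSeries hf).trans hs.symm)

theorem powerSumSeries_mul {f g : F[X]} (hf : f.Monic) (hg : g.Monic) :
    powerSumSeries (f * g) = powerSumSeries f + powerSumSeries g := by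
  refine powerSumSeries_eq (hf.mul hg) ?_
  have h1 := reverse_mul_powerSumSeries hf
  have h2 := reverse_mul_powerSumSeries hg
  rw [reverse_mul_of_domain, derivative_mul]
  push_cast
  linear_combination (g.reverse : PowerSeries F) * h1 + (f.reverse : PowerSeries F) * h2

theorem powerSum_mul (m : ℕ) {f g : F[X]} (hf : f.Monic) (hg : g.Monic) :
    powerSum m (f * g) = powerSum m f + powerSum m g := by
  simp [powerSum, powerSumSeries_mul hf hg]

theorem powerSum_one (m : ℕ) : powerSum m (1 : F[X]) = 0 := by
  simpa using powerSum_mul m (monic_one (R := F)) monic_one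

theorem powerSum_map (m : ℕ) (φ : F →+* K) {f : F[X]} (hf : f.Monic) :
    powerSum m (f.map φ) = φ (powerSum m f) := by
  have hr : (f.map φ).reverse = f.reverse.map φ := by
    rw [reverse, natDegree_map, reverse, reflect_map]
  have h := congrArg (PowerSeries.map φ) (reverse_mul_powerSumSeries hf)
  rw [powerSum, powerSumSeries_eq (hf.map φ) (s := PowerSeries.map φ (powerSumSeries f)),
    PowerSeries.coeff_map, powerSum]
  rw [hr, derivative_map, Polynomial.polynomial_map_coe, ← map_mul, h]
  simp

theorem powerSum_X_sub_C {m : ℕ} (hm : 0 < m) (a : F) : powerSum m (X - C a) = a ^ m := by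
  have hrev : (X - C a : F[X]).reverse = 1 - C a * X := by
    rw [sub_eq_add_neg, ← C_neg, reverse_add_C]
    have : (X : F[X]).reverse = 1 := by
      rw [← one_mul X, reverse_mul_X, ← C_1, reverse_C]
    simp [this, sub_eq_add_neg]
  rw [powerSum, powerSumSeries_eq (monic_X_sub_C a)
    (s := PowerSeries.mk fun i ↦ if i = 0 then 0 else a ^ i), PowerSeries.coeff_mk, if_neg hm.ne']
  rw [hrev]
  ext i
  rcases i with _ | i
  · simp
  · have h : PowerSeries.C a * PowerSeries.X *
        (PowerSeries.mk fun i ↦ if i = 0 then 0 else a ^ i) =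
        PowerSeries.X * (PowerSeries.C a * PowerSeries.mk fun i ↦ if i = 0 then 0 else a ^ i) := by
      ring
    rcases i with _ | i <;>
      simp [sub_mul, h, PowerSeries.coeff_succ_X_mul, PowerSeries.coeff_X, pow_succ']

theorem powerSum_multiset_prod_X_sub_C {m : ℕ} (hm : 0 < m) (s : Multiset F) :
    powerSum m (s.map fun a ↦ X - C a).prod = (s.map (· ^ m)).sum := by
  induction s using Multiset.induction with
  | empty => simp [powerSum_one]
  | cons a s ih =>
    rw [Multiset.map_cons, Multiset.prod_cons, powerSum_mul m (monic_X_sub_C a)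
      (monic_multiset_prod_of_monic _ _ fun a _ ↦ monic_X_sub_C a), ih, powerSum_X_sub_C hm]
    simp

theorem powerSum_add_C_mul_X_pow {f : F[X]} (hf : f.Monic) {j : ℕ} (hj : 0 < j)
    (hjn : j ≤ f.natDegree) (c : F) :
    powerSum j (f + C c * X ^ (f.natDegree - j)) = powerSum j f - j * c := by
  set g := f + C c * X ^ (f.natDegree - j) with hg
  have hdeg : (C c * X ^ (f.natDegree - j)).degree < f.degree := by
    rw [degree_eq_natDegree hf.ne_zero]
    exact (degree_C_mul_X_pow_le _ _).trans_lt (by exact_mod_cast (by lia))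
  have hgm : g.Monic := hf.add_of_left hdeg
  have hgd : g.natDegree = f.natDegree := natDegree_add_eq_left_of_degree_lt hdeg
  have hrev : g.reverse = f.reverse + C c * X ^ j := by
    rw [reverse, hgd, hg, reflect_add, reflect_C_mul_X_pow, revAt_le (Nat.sub_le _ _),
      Nat.sub_sub_self hjn, reverse]
  have hder : PowerSeries.X * ((derivative (C c * X ^ j : F[X]) : F[X]) : PowerSeries F) =
      PowerSeries.X ^ j * PowerSeries.C (j * c) := by
    obtain ⟨i, rfl⟩ := Nat.exists_eq_succ_of_ne_zero hj.ne'
    rw [derivative_C_mul_X_pow]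
    have : (((i : F[X]) : F[X]) : PowerSeries F) = i :=
      map_natCast (coeToPowerSeries.ringHom (R := F)) i
    simp [this]
    ring
  have h1 := reverse_mul_powerSumSeries hf
  have h2 := reverse_mul_powerSumSeries hgm
  rw [hrev, derivative_add] at h2
  push_cast at h2
  have h0 : PowerSeries.constantCoeff (powerSumSeries g) = 0 := by simp [powerSumSeries]
  have h3 : (f.reverse : PowerSeries F) * (f.reverse : PowerSeries F)⁻¹ = 1 := by
    refine PowerSeries.mul_inv_cancel _ ?_
    rw [constantCoeff_reverse hf]
    exact one_ne_zero
  have key : powerSumSeries g = powerSumSeries f - PowerSeries.X ^ j *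
      ((f.reverse : PowerSeries F)⁻¹ *
        (PowerSeries.C (j * c) + PowerSeries.C c * powerSumSeries g)) := by
    refine mul_left_cancel₀ (reverse_toPowerSeries_ne_zero hf) ?_
    linear_combination h2 - h1 - hder + PowerSeries.X ^ j *
        (PowerSeries.C (j * c) + PowerSeries.C c * powerSumSeries g) * h3
  rw [powerSum, key, map_sub, powerSum]
  congr 1
  rw [show PowerSeries.coeff j = PowerSeries.coeff (R := F) (0 + j) by rw [zero_add],
    PowerSeries.coeff_X_pow_mul, PowerSeries.coeff_zero_eq_constantCoeff_apply]
  simp [h0, hf.leadingCoeff]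
end

section
open IntermediateField
variable {F E : Type*} [Field F] [Field E] [Finite E] [Algebra F E]

theorem trace_pow_eq_powerSum_minpoly [Finite F] {m : ℕ} (hm : 0 < m) (x : E) :
    Algebra.trace F E (x ^ m) = Module.finrank F⟮x⟯ E • powerSum m (minpoly F x) := by
  classical
  have hx : IsIntegral F x := .of_finite F x
  let A := AlgebraicClosure F
  have hgen : Algebra.trace F F⟮x⟯ (AdjoinSimple.gen F x ^ m) = powerSum m (minpoly F x) := by
    apply (algebraMap F A).injective
    let pb := adjoin.powerBasis hx
    have hpb : pb.gen = AdjoinSimple.gen F x := adjoin.powerBasis_gen hx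
    have hmin : minpoly F pb.gen = minpoly F x := by rw [hpb, minpoly_gen]
    have hmonic : (minpoly F x).Monic := minpoly.monic hx
    have hprod := (IsAlgClosed.splits ((minpoly F x).map (algebraMap F A))).eq_prod_roots_of_monic
      (hmonic.map _)
    have hsep : (minpoly F x).Separable := Algebra.IsSeparable.isSeparable F x
    rw [← powerSum_map m _ hmonic, hprod, powerSum_multiset_prod_X_sub_C hm,
      trace_eq_sum_embeddings, ← hpb]
    rw [Fintype.sum_equiv pb.liftEquiv' _ fun y ↦ (y : A) ^ m, Finset.sum_mem_multiset _ _ (· ^ m),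
      Finset.sum_eq_multiset_sum, Multiset.toFinset_val, Multiset.dedup_eq_self.mpr, hmin]
    · rw [hmin]
      exact nodup_roots hsep.map
    · intro y
      rfl
    · intro σ
      simp
  have hxm : x ^ m = algebraMap F⟮x⟯ E (AdjoinSimple.gen F x ^ m) := by
    rw [map_pow, AdjoinSimple.algebraMap_gen]
  rw [← hgen, ← Algebra.trace_trace (S := F⟮x⟯), hxm, Algebra.trace_algebraMap,
    LinearMap.map_smul_of_tower]

theorem norm_eq_coeff_zero_minpoly_pow (x : E) :
    Algebra.norm F x =
      ((-1) ^ (minpoly F x).natDegree * (minpoly F x).coeff 0) ^ Module.finrank F⟮x⟯ E := by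
  have hx : IsIntegral F x := .of_finite F x
  have := Algebra.PowerBasis.norm_gen_eq_coeff_zero_minpoly (adjoin.powerBasis hx)
  rw [adjoin.powerBasis_gen hx, minpoly_gen, adjoin.powerBasis_dim] at this
  rw [Algebra.norm_eq_norm_adjoin, this]

theorem finrank_div_natDegree_minpoly (x : E) :
    Module.finrank F E / (minpoly F x).natDegree = Module.finrank F⟮x⟯ E := by
  have : Module.Finite F E := inferInstance
  have hx : IsIntegral F x := .of_finite F x
  rw [← Module.finrank_mul_finrank F F⟮x⟯ E, adjoin.finrank hx,
    Nat.mul_div_cancel_left _ (minpoly.natDegree_pos hx)]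

theorem card_filter_minpoly_eq [Finite F] [Fintype E] [DecidableEq F[X]] {P : F[X]} (hP : P.Monic)
    (hirr : Irreducible P) (hd : P.natDegree ∣ Module.finrank F E) :
    #{x : E | minpoly F x = P} = P.natDegree := by
  classical
  have := Fintype.ofFinite F
  have hdvd := hirr.natDegree_dvd_iff_dvd_X_pow_card_pow_sub_X.1 hd
  rw [← Module.natCard_eq_pow_finrank, ← Fintype.card_eq_nat_card] at hdvd
  have hsplit : (P.map (algebraMap F E)).Splits :=
    (FiniteField.isSplittingField_sub E F).splits'.of_dvd
      ((map_ne_zero (FiniteField.X_pow_card_sub_X_ne_zero F Fintype.one_lt_card)))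
      (map_dvd (mapRingHom (algebraMap F E)) hdvd)
  rw [← card_rootSet_eq_natDegree (PerfectField.separable_of_irreducible hirr) hsplit,
    ← Set.toFinset_card]
  congr 1
  ext x
  rw [mem_filter, Set.mem_toFinset, mem_rootSet]
  simp only [mem_univ, true_and]
  constructor
  · rintro rfl
    exact ⟨hP.ne_zero, minpoly.aeval F x⟩
  · rintro ⟨_, h⟩
    exact (minpoly.eq_of_irreducible_of_monic hirr h hP).symm

theorem sum_monicIrreducibles_eq_sum_minpoly [Finite F] [Fintype E] {R : Type*} [CommRing R]
    (v : F[X] → R) :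
    ∑ P ∈ monicIrreducibles F (Module.finrank F E) with P.natDegree ∣ Module.finrank F E,
      (P.natDegree : R) * v P = ∑ x : E, v (minpoly F x) := by
  classical
  have hmaps : ∀ x ∈ (univ : Finset E), minpoly F x ∈
      {P ∈ monicIrreducibles F (Module.finrank F E) | P.natDegree ∣ Module.finrank F E} := by
    intro x _
    have hx : IsIntegral F x := .of_finite F x
    have hd : (minpoly F x).natDegree ∣ Module.finrank F E := minpoly.degree_dvd hx
    exact mem_filter.2 ⟨mem_monicIrreducibles.2 ⟨minpoly.monic hx, minpoly.irreducible hx,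
      Nat.le_of_dvd Module.finrank_pos hd⟩, hd⟩
  refine Eq.trans (sum_congr rfl fun P hP ↦ ?_)
    (sum_fiberwise_of_maps_to hmaps fun x ↦ v (minpoly F x))
  rw [mem_filter, mem_monicIrreducibles] at hP
  rw [sum_congr rfl (g := fun _ ↦ v P) (fun x hx ↦ by rw [(mem_filter.1 hx).2]), sum_const,
    card_filter_minpoly_eq hP.1.1 hP.1.2.1 hP.2, nsmul_eq_mul]
end

section
variable {F R : Type*} [Field F] [CommRing R]

/-- The completely multiplicative function `f ↦ η (∏ aᵢ) * e (∑ aᵢ ^ m)` on monic polynomials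
with roots `aᵢ`. -/
noncomputable def gaussWeight (η : MulChar F R) (e : AddChar F R) (m : ℕ) (f : F[X]) : R :=
  η ((-1) ^ f.natDegree * f.coeff 0) * e (powerSum m f)

variable (η : MulChar F R) (e : AddChar F R) (m : ℕ)

theorem gaussWeight_one : gaussWeight η e m 1 = 1 := by
  simp [gaussWeight, powerSum_one]

theorem gaussWeight_mul {f g : F[X]} (hf : f.Monic) (hg : g.Monic) :
    gaussWeight η e m (f * g) = gaussWeight η e m f * gaussWeight η e m g := by
  rw [gaussWeight, hf.natDegree_mul hg, mul_coeff_zero, powerSum_mul m hf hg, pow_add,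
    mul_mul_mul_comm, map_mul, AddChar.map_add_eq_mul, gaussWeight, gaussWeight]
  ring

theorem gaussWeight_X_sub_C {m : ℕ} (hm : 0 < m) (a : F) :
    gaussWeight η e m (X - C a) = η a * e (a ^ m) := by
  rw [gaussWeight, powerSum_X_sub_C hm, natDegree_X_sub_C]
  simp

theorem gaussWeight_minpoly_pow [Finite F] {E : Type*} [Field E] [Finite E] [Algebra F E]
    {m : ℕ} (hm : 0 < m) (x : E) :
    gaussWeight η e m (minpoly F x) ^ (Module.finrank F E / (minpoly F x).natDegree) =
      η (Algebra.norm F x) * e (Algebra.trace F E (x ^ m)) := by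
  rw [finrank_div_natDegree_minpoly, gaussWeight, mul_pow, ← map_pow,
    ← norm_eq_coeff_zero_minpoly_pow, trace_pow_eq_powerSum_minpoly hm, AddChar.map_nsmul_eq_pow]

/-- The power sum over the degree `k` extension attached to `gaussWeight`. -/
theorem sum_gaussWeight_monicIrreducibles [Finite F] {E : Type*} [Field E] [Fintype E]
    [Algebra F E] {m : ℕ} (hm : 0 < m) {k : ℕ} (hk : Module.finrank F E = k) :
    ∑ P ∈ monicIrreducibles F k with P.natDegree ∣ k,
      (P.natDegree : R) * gaussWeight η e m P ^ (k / P.natDegree) =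
      ∑ x : E, η (Algebra.norm F x) * e (Algebra.trace F E (x ^ m)) := by
  subst hk
  rw [sum_monicIrreducibles_eq_sum_minpoly
    (v := fun P ↦ gaussWeight η e m P ^ (Module.finrank F E / P.natDegree))]
  exact sum_congr rfl fun x _ ↦ gaussWeight_minpoly_pow η e hm x

end

section
variable {R : Type*} [CommRing R]

theorem eq_neg_one_pow_mul_pow_of_newton {a T : ℕ → R} (h0 : a 0 = 1) (h2 : ∀ n, 2 ≤ n → a n = 0)
    (h : ∀ n : ℕ, (n : R) * a n = ∑ ij ∈ antidiagonal n with ij.1 < n, a ij.1 * T ij.2) (k : ℕ) :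
    T (k + 1) = (-1) ^ k * a 1 ^ (k + 1) := by
  induction k with
  | zero =>
    have := h 1
    rw [sum_filter, Nat.sum_antidiagonal_eq_sum_range_succ_mk] at this
    simp [h0] at this
    simp [this]
  | succ k ih =>
    have := h (k + 2)
    rw [h2 _ (by lia), sum_filter, Nat.sum_antidiagonal_eq_sum_range_succ_mk, sum_range_succ',
      sum_range_succ', sum_eq_zero (fun i _ ↦ by rw [h2 _ (by lia)]; simp)] at this
    simp [h0, ih] at this
    linear_combination -this

theorem eq_aeval_esymm_of_newton [IsDomain R] [CharZero R] {σ : Type*} [Fintype σ] (x : σ → R)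
    {b : ℕ → R} (h0 : b 0 = 1)
    (h : ∀ n : ℕ, (n : R) * b n = ∑ ij ∈ antidiagonal n with ij.1 < n,
      b ij.1 * ((-1) ^ (ij.2 - 1) * ∑ i, x i ^ ij.2)) (n : ℕ) :
    b n = MvPolynomial.aeval x (MvPolynomial.esymm σ R n) := by
  induction n using Nat.strong_induction_on with
  | _ n ih =>
    rcases Nat.eq_zero_or_pos n with rfl | hn
    · simp [h0]
    have hn' : (n : R) ≠ 0 := by exact_mod_cast hn.ne'
    apply mul_left_cancel₀ hn'
    have := congrArg (MvPolynomial.aeval x) (MvPolynomial.mul_esymm_eq_sum σ R n)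
    rw [map_mul, map_natCast] at this
    rw [this, h, map_mul, map_sum, mul_sum]
    refine sum_congr rfl fun ij hij ↦ ?_
    rw [mem_filter, HasAntidiagonal.mem_antidiagonal] at hij
    rw [ih _ hij.2]
    obtain ⟨k, hk⟩ : ∃ k, ij.2 = k + 1 := ⟨ij.2 - 1, by lia⟩
    have hsign : ((-1 : R)) ^ (n + 1) * (-1) ^ ij.1 = (-1) ^ k := by
      rw [← hij.1, hk, ← pow_add, show ij.1 + (k + 1) + 1 + ij.1 = 2 * (ij.1 + 1) + k by ring,
        pow_add, pow_mul]
      simp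
    simp only [map_mul, map_pow, map_neg, map_one, MvPolynomial.psum, map_sum,
      MvPolynomial.aeval_X]
    rw [hk, Nat.add_sub_cancel, ← hsign]
    ring

end

section
variable {F : Type*} [Field F] [Finite F] {R : Type*} [CommRing R]

theorem monicsOfDegree_zero : monicsOfDegree F 0 = {1} := by
  ext f
  rw [mem_monicsOfDegree, mem_singleton]
  constructor
  · rintro ⟨hf, hd⟩
    exact hf.natDegree_eq_zero.1 hd
  · rintro rfl
    exact ⟨monic_one, natDegree_one⟩

theorem sum_monicsOfDegree_one [Fintype F] (w : F[X] → R) :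
    ∑ f ∈ monicsOfDegree F 1, w f = ∑ a : F, w (X - C a) := by
  symm
  refine sum_bij (fun a _ ↦ X - C a) (fun a _ ↦ ?_) (fun a _ b _ h ↦ ?_) (fun f hf ↦ ?_)
    (fun _ _ ↦ rfl)
  · exact mem_monicsOfDegree.2 ⟨monic_X_sub_C a, natDegree_X_sub_C a⟩
  · exact C_injective (sub_right_injective h)
  · obtain ⟨hf, hd⟩ := mem_monicsOfDegree.1 hf
    refine ⟨-f.coeff 0, mem_univ _, ?_⟩
    rw [hf.eq_X_add_C hd]
    simp

theorem add_C_mul_X_pow_mem_monicsOfDegree {n i : ℕ} (hi : i < n) (c : F) {f : F[X]}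
    (hf : f ∈ monicsOfDegree F n) : f + C c * X ^ i ∈ monicsOfDegree F n := by
  obtain ⟨hf, hd⟩ := mem_monicsOfDegree.1 hf
  have hdeg : (C c * X ^ i).degree < f.degree := by
    rw [degree_eq_natDegree hf.ne_zero, hd]
    exact (degree_C_mul_X_pow_le _ _).trans_lt (by exact_mod_cast hi)
  exact mem_monicsOfDegree.2 ⟨hf.add_of_left hdeg,
    (natDegree_add_eq_left_of_degree_lt hdeg).trans hd⟩

theorem sum_monicsOfDegree_add_C_mul_X_pow {n i : ℕ} (hi : i < n) (c : F) (w : F[X] → R) :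
    ∑ f ∈ monicsOfDegree F n, w (f + C c * X ^ i) = ∑ f ∈ monicsOfDegree F n, w f :=
  sum_bij' (fun f _ ↦ f + C c * X ^ i) (fun f _ ↦ f + C (-c) * X ^ i)
    (fun _ hf ↦ add_C_mul_X_pow_mem_monicsOfDegree hi c hf)
    (fun _ hf ↦ add_C_mul_X_pow_mem_monicsOfDegree hi (-c) hf)
    (fun f _ ↦ by simp) (fun f _ ↦ by simp) (fun _ _ ↦ rfl)

theorem sum_monicsOfDegree_eq_sum_coeff_zero [Fintype F] [DecidableEq F] {n : ℕ} (hn : 0 < n)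
    (w : F[X] → R) : ∑ f ∈ monicsOfDegree F n, w f =
      ∑ f ∈ monicsOfDegree F n with f.coeff 0 = 0, ∑ c : F, w (f + C c) := by
  rw [← sum_product']
  have hmem (c : F) {f : F[X]} (hf : f ∈ monicsOfDegree F n) : f + C c ∈ monicsOfDegree F n := by
    simpa using add_C_mul_X_pow_mem_monicsOfDegree hn c hf
  refine sum_bij' (fun f _ ↦ (f + C (-f.coeff 0), f.coeff 0)) (fun fc _ ↦ fc.1 + C fc.2)
    (fun f hf ↦ ?_) (fun fc h ↦ ?_) (fun f _ ↦ by simp) (fun fc h ↦ ?_) (fun f _ ↦ by simp)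
  · exact mem_product.2 ⟨mem_filter.2 ⟨hmem _ hf, by simp⟩, mem_univ _⟩
  · exact hmem _ (mem_filter.1 (mem_product.1 h).1).1
  · have := (mem_filter.1 (mem_product.1 h).1).2
    ext1 <;> simp [this]

variable (η : MulChar F R) (e : AddChar F R)

theorem sum_gaussWeight_one_eq_zero [IsDomain R] (he : e ≠ 1) {n : ℕ} (hn : 2 ≤ n) :
    ∑ f ∈ monicsOfDegree F n, gaussWeight η e 1 f = 0 := by
  obtain ⟨t, ht⟩ := (AddChar.ne_one_iff).1 he
  have h := sum_monicsOfDegree_add_C_mul_X_pow (n := n) (i := n - 1) (by lia) (-t)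
    (gaussWeight η e 1)
  have hw : ∀ f ∈ monicsOfDegree F n, gaussWeight η e 1 (f + C (-t) * X ^ (n - 1)) =
      e t * gaussWeight η e 1 f := by
    intro f hf
    obtain ⟨hf1, hd⟩ := mem_monicsOfDegree.1 hf
    have hd' := (mem_monicsOfDegree.1
      (add_C_mul_X_pow_mem_monicsOfDegree (i := n - 1) (by lia) (-t) hf)).2
    have hp := powerSum_add_C_mul_X_pow hf1 one_pos (by lia) (-t)
    rw [hd] at hp
    rw [gaussWeight, gaussWeight, hp, hd', hd, sub_eq_add_neg, AddChar.map_add_eq_mul, coeff_add,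
      coeff_C_mul, coeff_X_pow, if_neg (by lia)]
    simp
    ring
  rw [sum_congr rfl hw, ← mul_sum] at h
  have : (e t - 1) * ∑ f ∈ monicsOfDegree F n, gaussWeight η e 1 f = 0 := by
    rw [sub_mul, h]; ring
  exact (mul_eq_zero.1 this).resolve_left (sub_ne_zero.2 ht)

/-- The Hasse–Davenport lifting relation. -/
theorem gaussSum_lift [IsDomain R] [Fintype F] (he : e ≠ 1) {E : Type*} [Field E] [Fintype E]
    [Algebra F E] : ∑ x : E, η (Algebra.norm F x) * e (Algebra.trace F E x) =
      (-1) ^ (Module.finrank F E - 1) * (∑ x : F, η x * e x) ^ Module.finrank F E := by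
  have hE := sum_gaussWeight_monicIrreducibles η e one_pos (E := E) rfl
  simp only [pow_one] at hE
  obtain ⟨k, hk⟩ : ∃ k, Module.finrank F E = k + 1 :=
    ⟨Module.finrank F E - 1, by have := Module.finrank_pos (R := F) (M := E); lia⟩
  rw [← hE, hk, Nat.add_sub_cancel]
  have := eq_neg_one_pow_mul_pow_of_newton
    (a := fun n ↦ ∑ f ∈ monicsOfDegree F n, gaussWeight η e 1 f)
    (T := fun n ↦ ∑ P ∈ monicIrreducibles F n with P.natDegree ∣ n,
      (P.natDegree : R) * gaussWeight η e 1 P ^ (n / P.natDegree))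
    (by simp [monicsOfDegree_zero, gaussWeight_one])
    (fun n hn ↦ sum_gaussWeight_one_eq_zero η e he hn)
    (natCast_mul_sum_monicsOfDegree (gaussWeight_one η e 1)
      fun f g hf hg ↦ gaussWeight_mul η e 1 hf hg) k
  rw [this, sum_monicsOfDegree_one]
  simp only [gaussWeight_X_sub_C η e one_pos, pow_one]

end

section

theorem exists_pow_eq_iff_pow_card_div_eq_one {G : Type*} [CommGroup G] [IsCyclic G] [Finite G]
    {m : ℕ} (hm : m ∣ Nat.card G) (x : G) :
    (∃ y, y ^ m = x) ↔ x ^ (Nat.card G / m) = 1 := by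
  have hle : (powMonoidHom m : G →* G).range ≤ (powMonoidHom (Nat.card G / m) : G →* G).ker := by
    rintro _ ⟨y, rfl⟩
    simp [MonoidHom.mem_ker, ← pow_mul, Nat.mul_div_cancel' hm]
  have heq := Subgroup.eq_of_le_of_card_ge hle (by
    rw [IsCyclic.card_powMonoidHom_range, IsCyclic.card_powMonoidHom_ker,
      Nat.gcd_eq_right hm, Nat.gcd_eq_right (Nat.div_dvd_of_dvd hm)])
  exact SetLike.ext_iff.1 heq x

theorem card_filter_pow_eq {G : Type*} [CommGroup G] [IsCyclic G] [Fintype G] [DecidableEq G]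
    {m : ℕ} (hm : m ∣ Nat.card G) (x : G) :
    #{y : G | y ^ m = x} = if x ^ (Nat.card G / m) = 1 then m else 0 := by
  have h1 : #{y : G | y ^ m = 1} = m := by
    rw [← Fintype.card_subtype, ← Nat.card_eq_fintype_card]
    exact (IsCyclic.card_powMonoidHom_ker G m).trans (Nat.gcd_eq_right hm)
  simp only [← exists_pow_eq_iff_pow_card_div_eq_one hm]
  split_ifs with hx
  · exact (MonoidHom.card_fiber_eq_of_mem_range (powMonoidHom m : G →* G) hx
      ⟨1, one_pow m⟩).trans h1
  · rw [card_eq_zero, filter_eq_empty_iff]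
    exact fun y _ hy ↦ hx ⟨y, hy⟩

variable {F : Type*} [Field F] [Fintype F] {R : Type*} [CommRing R]
  [HasEnoughRootsOfUnity R (Monoid.exponent Fˣ)] [Fintype (MulChar F R)] [DecidableEq (MulChar F R)]

theorem card_mulChar_pow_eq_one {m : ℕ} (hm : m ∣ Nat.card Fˣ) :
    #{χ : MulChar F R | χ ^ m = 1} = m := by
  obtain ⟨φ⟩ := MulChar.mulEquiv_units F R
  have : IsCyclic (MulChar F R) := φ.isCyclic.2 inferInstance
  rw [card_filter_pow_eq (by rwa [Nat.card_congr φ.toEquiv]), one_pow, if_pos rfl]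

variable [IsDomain R]

theorem sum_mulChar_apply [DecidableEq F] {m : ℕ} (hm : m ∣ Nat.card Fˣ) {a : F} (ha : a ≠ 0) :
    ∑ χ : MulChar F R with χ ^ m = 1, χ a = if a ^ (Nat.card Fˣ / m) = 1 then (m : R) else 0 := by
  split_ifs with h
  · obtain ⟨z, hz⟩ := (exists_pow_eq_iff_pow_card_div_eq_one hm (Units.mk0 a ha)).2
      (Units.ext (by simpa using h))
    have hz' : a = (z : F) ^ m := by simpa using (congrArg Units.val hz).symm
    have : ∀ χ ∈ ({χ | χ ^ m = 1} : Finset (MulChar F R)), χ a = 1 := by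
      intro χ hχ
      rw [hz', map_pow, ← MulChar.pow_apply_coe, (mem_filter.1 hχ).2, MulChar.one_apply_coe]
    rw [sum_congr rfl this, sum_const, card_mulChar_pow_eq_one hm, nsmul_one]
  · obtain ⟨χ₀, h₀⟩ := MulChar.exists_apply_ne_one_of_hasEnoughRootsOfUnity F R h
    set χ₁ := χ₀ ^ (Nat.card Fˣ / m) with hχ₁
    have h₁ : χ₁ a ≠ 1 := by
      rwa [hχ₁, ← Units.val_mk0 ha, MulChar.pow_apply_coe, Units.val_mk0, ← map_pow]
    have hpow : χ₁ ^ m = 1 := by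
      rw [hχ₁, ← pow_mul, Nat.div_mul_cancel hm, Nat.card_eq_fintype_card, MulChar.pow_card_eq_one]
    have hsum : ∑ χ : MulChar F R with χ ^ m = 1, (χ₁ * χ) a =
        ∑ χ : MulChar F R with χ ^ m = 1, χ a :=
      sum_bijective (χ₁ * ·) (Group.mulLeft_bijective χ₁)
        (fun χ ↦ by simp [mul_pow, hpow]) (fun _ _ ↦ rfl)
    simp only [MulChar.mul_apply, ← mul_sum] at hsum
    have := sub_eq_zero.2 hsum
    rw [← sub_one_mul] at this
    exact (mul_eq_zero.1 this).resolve_left (sub_ne_zero.2 h₁)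

variable {E : Type*} [Field E] [Fintype E] [DecidableEq E] [Algebra F E]

theorem sum_mulChar_norm {m : ℕ} (hm : m ∣ Nat.card Fˣ) {x : E} (hx : x ≠ 0) :
    ∑ χ : MulChar F R with χ ^ m = 1, χ (Algebra.norm F x) = #{y : E | y ^ m = x} := by
  classical
  have hm0 : m ≠ 0 := by
    rintro rfl
    exact Nat.card_pos.ne' (Nat.eq_zero_of_zero_dvd hm)
  have hdvd : Nat.card Fˣ ∣ Nat.card Eˣ := by
    rw [Nat.card_units, Nat.card_units, Module.natCard_eq_pow_finrank (K := F) (V := E)]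
    simpa using Nat.sub_dvd_pow_sub_pow (Nat.card F) 1 (Module.finrank F E)
  have hcard : #{y : E | y ^ m = x} = #{y : Eˣ | y ^ m = Units.mk0 x hx} := by
    symm
    refine card_nbij (fun y : Eˣ ↦ (y : E)) (fun y hy ↦ ?_) Units.val_injective.injOn (fun y hy ↦ ?_)
    · simpa using congrArg Units.val (mem_filter.1 hy).2
    · have hy' : y ^ m = x := (mem_filter.1 hy).2
      have hy0 : y ≠ 0 := by
        rintro rfl
        exact hx (by rw [← hy', zero_pow hm0])
      exact ⟨Units.mk0 y hy0, by simp [Units.ext_iff, hy'], rfl⟩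
  rw [sum_mulChar_apply hm (Algebra.norm_ne_zero_iff.2 hx), hcard,
    card_filter_pow_eq (hm.trans hdvd)]
  have hiff : Algebra.norm F x ^ (Nat.card Fˣ / m) = 1 ↔
      Units.mk0 x hx ^ (Nat.card Eˣ / m) = 1 := by
    rw [← (algebraMap F E).injective.eq_iff, map_pow, FiniteField.algebraMap_norm_eq_pow, map_one,
      ← Nat.card_units, ← Nat.card_units, ← pow_mul, Nat.div_mul_div_comm hdvd hm, mul_comm _ m,
      Nat.mul_div_mul_right _ _ Nat.card_pos, Units.ext_iff]
    simp
  simp only [hiff]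
  split_ifs <;> simp

/-- Summing twisted character sums over the characters of order dividing `m` amounts to
substituting `m`-th powers. -/
theorem sum_mulChar_sum_norm {m : ℕ} (hm : m ∣ Nat.card Fˣ) (ψ : MulChar F R) (h : E → R) :
    ∑ χ : MulChar F R with χ ^ m = 1, ∑ x : E, (χ * ψ) (Algebra.norm F x) * h x =
      ∑ y : E, (ψ ^ m) (Algebra.norm F y) * h (y ^ m) := by
  have hm0 : m ≠ 0 := by
    rintro rfl
    exact Nat.card_pos.ne' (Nat.eq_zero_of_zero_dvd hm)
  rw [sum_comm, ← sum_fiberwise univ (fun y : E ↦ y ^ m)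
    (fun y ↦ (ψ ^ m) (Algebra.norm F y) * h (y ^ m))]
  refine sum_congr rfl fun x _ ↦ ?_
  simp only [MulChar.mul_apply, MulChar.pow_apply' _ hm0, ← map_pow]
  have hfib : ∀ y ∈ ({y | y ^ m = x} : Finset E), ψ (Algebra.norm F (y ^ m)) * h (y ^ m) =
      ψ (Algebra.norm F x) * h x := fun y hy ↦ by rw [(mem_filter.1 hy).2]
  rw [sum_congr rfl hfib, sum_const, nsmul_eq_mul]
  rcases eq_or_ne x 0 with rfl | hx
  · simp [MulChar.map_zero]
  · rw [← sum_mulChar_norm (R := R) hm hx, sum_mul]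
    simp only [mul_assoc]

end

section
variable {F : Type*} [Field F] [Fintype F] {R : Type*} [CommRing R]

theorem gaussSum_pow_eq_sum (ψ : MulChar F R) (e : AddChar F R) {m : ℕ} (hm : 0 < m)
    (hmF : (m : F) ≠ 0) : ∑ c : F, (ψ ^ m) ((-1) ^ m * c) * e (-(m * c)) =
      ψ (((m : F) ^ m)⁻¹) * gaussSum (ψ ^ m) e := by
  rw [gaussSum, mul_sum]
  refine Fintype.sum_equiv (Equiv.mulLeft₀ (-(m : F)) (neg_ne_zero.2 hmF)) _ _ fun c ↦ ?_
  rw [show Equiv.mulLeft₀ (-(m : F)) _ c = -m * c from rfl, ← mul_assoc, ← neg_mul]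
  congr 1
  rw [MulChar.pow_apply' _ hm.ne', MulChar.pow_apply' _ hm.ne', ← map_pow, ← map_pow, ← map_mul]
  congr 1
  have hsign : ((-1 : F) ^ m) ^ m = (-1) ^ m := by
    rcases neg_one_pow_eq_or F m with h | h <;> rw [h]
    · simp
    · exact h
  rw [mul_pow, mul_pow, neg_pow (m : F), hsign]
  field_simp

/-- Summing first over the constant coefficient of `f` pulls out a Gauss sum; the remaining factor
does not depend on `ψ`. -/
theorem sum_gaussWeight_pow_monicsOfDegree [DecidableEq F] (ψ : MulChar F R) (e : AddChar F R)
    {m : ℕ} (hm : 0 < m) (hmF : (m : F) ≠ 0) :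
    ∑ f ∈ monicsOfDegree F m, gaussWeight (ψ ^ m) e m f =
      ψ (((m : F) ^ m)⁻¹) * gaussSum (ψ ^ m) e *
        ∑ f ∈ monicsOfDegree F m with f.coeff 0 = 0, e (powerSum m f) := by
  rw [sum_monicsOfDegree_eq_sum_coeff_zero hm, ← gaussSum_pow_eq_sum ψ e hm hmF, mul_sum]
  refine sum_congr rfl fun f hf ↦ ?_
  rw [sum_mul]
  refine sum_congr rfl fun c _ ↦ ?_
  obtain ⟨hf, h0⟩ := mem_filter.1 hf
  obtain ⟨hmonic, hd⟩ := mem_monicsOfDegree.1 hf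
  have hp := powerSum_add_C_mul_X_pow hmonic hm hd.ge c
  have hd' := (mem_monicsOfDegree.1 (add_C_mul_X_pow_mem_monicsOfDegree hm c hf)).2
  rw [hd, Nat.sub_self] at hp
  rw [pow_zero, mul_one] at hp hd'
  rw [gaussWeight, hp, hd', coeff_add, h0, zero_add, coeff_C_zero, sub_eq_neg_add,
    AddChar.map_add_eq_mul, mul_assoc]

theorem sum_gaussWeight_pow_monicsOfDegree_eq_prod_gaussSum [IsDomain R] [CharZero R]
    [HasEnoughRootsOfUnity R (Monoid.exponent Fˣ)] [Fintype (MulChar F R)]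
    [DecidableEq (MulChar F R)] (ψ : MulChar F R) {e : AddChar F R} (he : e ≠ 1) {m : ℕ}
    (hm : m ∣ Nat.card Fˣ) : ∑ f ∈ monicsOfDegree F m, gaussWeight (ψ ^ m) e m f =
      ∏ χ : MulChar F R with χ ^ m = 1, gaussSum (χ * ψ) e := by
  classical
  have hm0 : 0 < m := Nat.pos_of_dvd_of_pos hm Nat.card_pos
  let p := ringChar F
  have : Fact p.Prime := ⟨CharP.char_is_prime F p⟩
  let σ := {χ : MulChar F R // χ ^ m = 1}
  have hmem : ∀ χ, χ ∈ ({χ | χ ^ m = 1} : Finset (MulChar F R)) ↔ χ ^ m = 1 := by simp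
  have hσ : Fintype.card σ = m := by rw [Fintype.card_subtype, card_mulChar_pow_eq_one hm]
  rw [eq_aeval_esymm_of_newton (σ := σ) (fun χ ↦ gaussSum (χ.1 * ψ) e)
    (b := fun n ↦ ∑ f ∈ monicsOfDegree F n, gaussWeight (ψ ^ m) e m f)
    (by simp [monicsOfDegree_zero, gaussWeight_one]) (fun n ↦ ?_) m, MvPolynomial.esymm]
  · have huniv : powersetCard m (univ : Finset σ) = {univ} := by
      simpa only [card_univ, hσ] using powersetCard_self (univ : Finset σ)
    rw [huniv, sum_singleton, map_prod]
    simp only [MvPolynomial.aeval_X]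
    exact (prod_subtype _ hmem fun χ ↦ gaussSum (χ * ψ) e).symm
  · rw [natCast_mul_sum_monicsOfDegree (gaussWeight_one _ e m)
      fun f g hf hg ↦ gaussWeight_mul _ e m hf hg]
    refine sum_congr rfl fun ij hij ↦ ?_
    rw [mem_filter, HasAntidiagonal.mem_antidiagonal] at hij
    have : NeZero ij.2 := ⟨by lia⟩
    let E := FiniteField.Extension F p ij.2
    have : Finite E := Module.finite_of_finite F
    have := Fintype.ofFinite E
    have hE : Module.finrank F E = ij.2 := FiniteField.finrank_extension F p ij.2
    rw [sum_gaussWeight_monicIrreducibles _ e hm0 hE,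
      ← sum_mulChar_sum_norm hm ψ (fun x : E ↦ e (Algebra.trace F E x))]
    congr 1
    simp_rw [gaussSum_lift _ e he, hE]
    rw [← mul_sum]
    congr 1
    exact sum_subtype _ hmem fun χ ↦ gaussSum (χ * ψ) e ^ ij.2

/-- The Hasse–Davenport product relation for a nontrivial additive character. -/
theorem prod_gaussSum_mul [IsDomain R] [CharZero R]
    [HasEnoughRootsOfUnity R (Monoid.exponent Fˣ)] [Fintype (MulChar F R)]
    [DecidableEq (MulChar F R)] (ψ : MulChar F R) {e : AddChar F R} (he : e ≠ 1) {m : ℕ}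
    (hm : m ∣ Nat.card Fˣ) : ∏ χ : MulChar F R with χ ^ m = 1, gaussSum (χ * ψ) e =
      -gaussSum (ψ ^ m) e * ψ (((m : F) ^ m)⁻¹) *
        ∏ χ : MulChar F R with χ ^ m = 1, gaussSum χ e := by
  classical
  have hm0 : 0 < m := Nat.pos_of_dvd_of_pos hm Nat.card_pos
  have hmF : (m : F) ≠ 0 := by
    have : ((Nat.card Fˣ : ℕ) : F) ≠ 0 := by
      rw [Nat.card_units, Nat.cast_sub Nat.card_pos, Nat.card_eq_fintype_card,
        FiniteField.cast_card_eq_zero]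
      simp
    intro h
    obtain ⟨k, hk⟩ := hm
    exact this (by rw [hk, Nat.cast_mul, h, zero_mul])
  have hψ := sum_gaussWeight_pow_monicsOfDegree ψ e hm0 hmF
  have hε := sum_gaussWeight_pow_monicsOfDegree (1 : MulChar F R) e hm0 hmF
  rw [sum_gaussWeight_pow_monicsOfDegree_eq_prod_gaussSum _ he hm] at hψ hε
  simp only [mul_one, one_pow, gaussSum_one_left he] at hε
  rw [MulChar.one_apply (isUnit_iff_ne_zero.2 (inv_ne_zero (pow_ne_zero m hmF)))] at hε
  rw [hψ, hε]
  ring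

end

end HasseDavenport

open Classical in
/-- The Hasse–Davenport product relation: for `F_q` a finite field of odd characteristic
`p`, `m` a positive divisor of `q - 1` and `ψ` any multiplicative character of `F_q`,
`∏_{χ^m = ε} g(χψ) = -g(ψ^m) ψ(m^{-m}) ∏_{χ^m = ε} g(χ)`, with
`g(χ) = ∑_{x ∈ F_q^×} χ(x) ζ_p^{Tr(x)}`. -/
theorem hasse_davenport_product (p : ℕ) [Fact p.Prime] (hp : Odd p)
    (F : Type) [Field F] [Fintype F] [Algebra (ZMod p) F] [CharP F p]
    (ζ : ℂ) (hζ : IsPrimitiveRoot ζ p)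
    (m : ℕ) (hm : 0 < m) (hmq : m ∣ Fintype.card F - 1) (ψ : MulChar F ℂ) :
    (∏ᶠ (χ : MulChar F ℂ) (_ : χ ^ m = 1),
        ∑ x : F, (χ * ψ) x * ζ ^ (Algebra.trace (ZMod p) F x).val) =
      -(∑ x : F, (ψ ^ m) x * ζ ^ (Algebra.trace (ZMod p) F x).val) *
        ψ (((m : F) ^ m)⁻¹) *
        ∏ᶠ (χ : MulChar F ℂ) (_ : χ ^ m = 1),
          ∑ x : F, χ x * ζ ^ (Algebra.trace (ZMod p) F x).val := by
  let e : AddChar F ℂ := (AddChar.zmodChar p hζ.pow_eq_one).compAddMonoidHom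
    (Algebra.trace (ZMod p) F).toAddMonoidHom
  have he_apply (x : F) : e x = ζ ^ (Algebra.trace (ZMod p) F x).val := rfl
  have he : e ≠ 1 := by
    obtain ⟨x, hx⟩ := Algebra.trace_surjective (ZMod p) F 1
    refine AddChar.ne_one_iff.2 ⟨x, ?_⟩
    have : Fact (1 < p) := ⟨(Fact.out : p.Prime).one_lt⟩
    rw [he_apply, hx, ZMod.val_one, pow_one]
    exact hζ.ne_one this.out
  have hm' : m ∣ Nat.card Fˣ := by rwa [Nat.card_units, Nat.card_eq_fintype_card]
  have := Fintype.ofFinite (MulChar F ℂ)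
  have : NeZero (Monoid.exponent Fˣ) := ⟨Monoid.exponent_ne_zero_of_finite⟩
  have hprod (g : MulChar F ℂ → ℂ) :
      ∏ᶠ (χ : MulChar F ℂ) (_ : χ ^ m = 1), g χ = ∏ χ : MulChar F ℂ with χ ^ m = 1, g χ :=
    finprod_cond_eq_prod_of_cond_iff _ (by simp)
  rw [hprod, hprod]
  exact HasseDavenport.prod_gaussSum_mul ψ he hm'
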